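/- The sets V(E) = {φ̄ ∈ V*/ℝ_{>0} | φ(λ) < 0 for all λ ∈ E}, where E runs over the finite subsets of Λ, form a basis of open sets for the quotient topology on V*/ℝ_{>0}. -/

import Mathlib

open scoped TensorProduct

variable (Λ : Type) [AddCommGroup Λ]

/-- The real vector space `V = ℝ ⊗_ℤ Λ` spanned by the lattice `Λ`. -/
abbrev RV : Type := ℝ ⊗[ℤ] Λ

/-- The canonical map `Λ → ℝ ⊗_ℤ Λ`, `λ ↦ 1 ⊗ λ`. -/
noncomputable def iota : Λ →ₗ[ℤ] RV Λ := TensorProduct.mk ℤ ℝ Λ 1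

/-- The weak topology on the dual space `V*` (`V` being finite dimensional, this is
its standard topology). -/
noncomputable instance dualTop : TopologicalSpace (Module.Dual ℝ (RV Λ)) :=
  ⨅ v : RV Λ, TopologicalSpace.induced (fun φ => φ v) inferInstance

/-- Two linear forms on `V` are equivalent iff they differ by a strictly positive scalar. -/
def dualSetoid : Setoid (Module.Dual ℝ (RV Λ)) where
  r φ ψ := ∃ κ : ℝ, 0 < κ ∧ ψ = κ • φ
  iseqv := by
    constructor
    · exact fun φ => ⟨1, one_pos, (one_smul ℝ φ).symm⟩
    · rintro φ ψ ⟨κ, hκ, rfl⟩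
      exact ⟨κ⁻¹, inv_pos.2 hκ, by rw [smul_smul, inv_mul_cancel₀ hκ.ne', one_smul]⟩
    · rintro φ ψ χ ⟨κ, hκ, rfl⟩ ⟨κ', hκ', rfl⟩
      exact ⟨κ' * κ, mul_pos hκ' hκ, smul_smul κ' κ φ⟩

/-- `V*/ℝ_{>0}`, the quotient of the dual space by positive rescaling, endowed with
the quotient topology. -/
abbrev DualQuot : Type := Quotient (dualSetoid Λ)

/-- `V(E) = {φ̄ ∈ V*/ℝ_{>0} | φ(λ) < 0 for all λ ∈ E}`. -/
def VQ (E : Set Λ) : Set (DualQuot Λ) :=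
  {q | ∀ φ : Module.Dual ℝ (RV Λ), Quotient.mk (dualSetoid Λ) φ = q → ∀ l ∈ E, φ (iota Λ l) < 0}

theorem mem_VQ_mk (E : Set Λ) (φ : Module.Dual ℝ (RV Λ)) :
    Quotient.mk (dualSetoid Λ) φ ∈ VQ Λ E ↔ ∀ l ∈ E, φ (iota Λ l) < 0 := by
  constructor
  · intro h
    exact h φ rfl
  · intro h ψ hψ l hl
    obtain ⟨κ, hκ, h2⟩ : ∃ κ : ℝ, 0 < κ ∧ φ = κ • ψ := Quotient.exact hψ
    have h1 := h l hl
    rw [h2, LinearMap.smul_apply, smul_eq_mul] at h1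
    by_contra h3
    have := mul_nonneg hκ.le (not_lt.1 h3)
    linarith

theorem continuous_eval_dual (v : RV Λ) :
    Continuous (fun φ : Module.Dual ℝ (RV Λ) => φ v) :=
  continuous_iff_le_induced.2 (iInf_le _ v)

theorem isOpen_VQ (E : Finset Λ) : IsOpen (VQ Λ (E : Set Λ)) := by
  have : IsOpen (Quotient.mk (dualSetoid Λ) ⁻¹' (VQ Λ (E : Set Λ))) := by
    have h : Quotient.mk (dualSetoid Λ) ⁻¹' (VQ Λ (E : Set Λ)) =
        ⋂ l ∈ E, {φ : Module.Dual ℝ (RV Λ) | φ (iota Λ l) < 0} := by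
      ext φ
      rw [Set.mem_preimage, mem_VQ_mk]
      simp
    rw [h]
    exact isOpen_biInter_finset fun l _ =>
      isOpen_lt (continuous_eval_dual Λ _) continuous_const
  exact this

theorem dual_open_ball {ι : Type} [Fintype ι] (b : Module.Basis ι ℝ (RV Λ))
    (U : Set (Module.Dual ℝ (RV Λ))) (hU : IsOpen U) (φ : Module.Dual ℝ (RV Λ)) (hφ : φ ∈ U) :
    ∃ ε > 0, ∀ ψ : Module.Dual ℝ (RV Λ), (∀ i, |ψ (b i) - φ (b i)| < ε) → ψ ∈ U := by
  let F : Module.Dual ℝ (RV Λ) → (ι → ℝ) := fun φ i => φ (b i)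
  have hle : TopologicalSpace.induced F inferInstance ≤ dualTop Λ := by
    refine le_iInf fun v => ?_
    let _ : TopologicalSpace (Module.Dual ℝ (RV Λ)) := TopologicalSpace.induced F inferInstance
    have hF : Continuous F := continuous_induced_dom
    have : Continuous (fun φ : Module.Dual ℝ (RV Λ) => φ v) := by
      have h : (fun φ : Module.Dual ℝ (RV Λ) => φ v) = fun φ => ∑ i, b.repr v i * F φ i := by
        funext φ
        conv_lhs => rw [← b.sum_repr v]
        rw [map_sum]
        exact Finset.sum_congr rfl fun i _ => by rw [map_smul, smul_eq_mul]
      rw [h]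
      exact continuous_finsetSum _ fun i _ =>
        continuous_const.mul ((continuous_apply i).comp hF)
    exact continuous_iff_le_induced.1 this
  obtain ⟨W, hW, rfl⟩ := isOpen_induced_iff.1 (hle U hU)
  obtain ⟨ε, hε, hb⟩ := Metric.isOpen_iff.1 hW (F φ) hφ
  refine ⟨ε, hε, fun ψ h => hb ?_⟩
  rw [Metric.mem_ball, dist_pi_lt_iff hε]
  exact h

theorem statement14 [Module.Free ℤ Λ] [Module.Finite ℤ Λ] :
    TopologicalSpace.IsTopologicalBasis
      {s : Set (DualQuot Λ) | ∃ E : Finset Λ, s = VQ Λ (E : Set Λ)} := by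
  classical
  refine TopologicalSpace.isTopologicalBasis_of_isOpen_of_nhds ?_ ?_
  · rintro _ ⟨E, rfl⟩
    exact isOpen_VQ Λ E
  intro q U hq hU
  suffices h : ∃ E : Finset Λ, q ∈ VQ Λ (E : Set Λ) ∧ VQ Λ (E : Set Λ) ⊆ U by
    obtain ⟨E, h1, h2⟩ := h
    exact ⟨_, ⟨E, rfl⟩, h1, h2⟩
  let c := Module.Free.chooseBasis ℤ Λ
  let b : Module.Basis _ ℝ (RV Λ) := Algebra.TensorProduct.basis ℝ c
  have hb : ∀ i, b i = iota Λ (c i) := fun i => by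
    exact Algebra.TensorProduct.basis_apply c i
  have hU' : IsOpen (Quotient.mk (dualSetoid Λ) ⁻¹' U) := hU
  have hsc : ∀ (φ : Module.Dual ℝ (RV Λ)) (κ : ℝ), 0 < κ →
      Quotient.mk (dualSetoid Λ) (κ • φ) = Quotient.mk (dualSetoid Λ) φ := fun φ κ hκ =>
    (Quotient.sound (s := dualSetoid Λ) (a := φ) (b := κ • φ) ⟨κ, hκ, rfl⟩).symm
  induction q using Quotient.inductionOn with | _ φ₀ => ?_
  by_cases h0 : φ₀ = 0
  · subst h0
    refine ⟨∅, by rw [mem_VQ_mk]; simp, ?_⟩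
    intro q _
    induction q using Quotient.inductionOn with | _ ψ => ?_
    obtain ⟨ε, hε, h⟩ := dual_open_ball Λ b _ hU' 0 hq
    -- rescale psi
    set M : ℝ := ∑ i, |ψ (b i)| with hM
    have hM0 : 0 ≤ M := Finset.sum_nonneg fun i _ => abs_nonneg _
    have hk : 0 < ε / (M + 1) := by positivity
    rw [← hsc ψ _ hk]
    apply h
    intro i
    have hi : |ψ (b i)| ≤ M :=
      Finset.single_le_sum (f := fun i => |ψ (b i)|) (fun i _ => abs_nonneg _) (Finset.mem_univ i)
    simp only [LinearMap.smul_apply, smul_eq_mul, LinearMap.zero_apply, sub_zero, abs_mul,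
      abs_of_pos hk]
    rw [div_mul_eq_mul_div, div_lt_iff₀ (by positivity)]
    nlinarith
  · obtain ⟨e, he⟩ : ∃ e : Λ, φ₀ (iota Λ e) < 0 := by
      by_contra! hcon
      apply h0
      apply b.ext
      intro i
      have h1 := hcon (c i)
      have h2 := hcon (- c i)
      rw [map_neg, map_neg] at h2
      rw [hb, LinearMap.zero_apply]
      linarith
    have hk : 0 < (- φ₀ (iota Λ e))⁻¹ := inv_pos.2 (by linarith)
    rw [← hsc φ₀ _ hk] at hq ⊢
    have hφe : ((- φ₀ (iota Λ e))⁻¹ • φ₀) (iota Λ e) = -1 := by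
      rw [LinearMap.smul_apply, smul_eq_mul]
      rw [inv_neg, neg_mul, inv_mul_cancel₀ he.ne]
    generalize (- φ₀ (iota Λ e))⁻¹ • φ₀ = φ at hq hφe
    obtain ⟨ε, hε, h⟩ := dual_open_ball Λ b _ hU' φ hq
    choose p hp1 hp2 using fun i => exists_rat_btwn (show φ (b i) - ε < φ (b i) by linarith)
    choose r hr1 hr2 using fun i => exists_rat_btwn (show φ (b i) < φ (b i) + ε by linarith)
    have key : ∀ (ψ : Module.Dual ℝ (RV Λ)), ψ (iota Λ e) = -1 → ∀ i (t : ℚ),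
        ψ (iota Λ ((t.den : ℤ) • c i + t.num • e)) = t.den * (ψ (b i) - t) := by
      intro ψ hψ i t
      have ht : (t : ℝ) * t.den = t.num := by exact_mod_cast Rat.mul_den_eq_num t
      rw [map_add, map_add, map_zsmul, map_zsmul, map_zsmul, map_zsmul, hψ, ← hb, mul_sub,
        mul_comm (t.den : ℝ) (t : ℝ), ht]
      simp
      ring
    have hden : ∀ t : ℚ, (0 : ℝ) < t.den := fun t => by exact_mod_cast t.den_pos
    let E : Finset Λ := insert e
      (Finset.univ.image (fun i => ((r i).den : ℤ) • c i + (r i).num • e) ∪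
       Finset.univ.image (fun i => -(((p i).den : ℤ) • c i + (p i).num • e)))
    have hE : ∀ ψ : Module.Dual ℝ (RV Λ), ψ (iota Λ e) = -1 →
        ((∀ l ∈ (E : Set Λ), ψ (iota Λ l) < 0) ↔ ∀ i, ψ (b i) < r i ∧ p i < ψ (b i)) := by
      intro ψ hψ
      constructor
      · intro hl i
        have h1 := hl (((r i).den : ℤ) • c i + (r i).num • e) (by simp [E])
        have h2 := hl (-(((p i).den : ℤ) • c i + (p i).num • e)) (by simp [E])
        rw [key ψ hψ] at h1
        rw [map_neg, map_neg, key ψ hψ] at h2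
        have d1 := hden (r i)
        have d2 := hden (p i)
        constructor
        · by_contra! hc
          have := mul_nonneg d1.le (sub_nonneg.2 hc)
          linarith
        · by_contra! hc
          have := mul_nonneg d2.le (sub_nonneg.2 hc)
          linarith
      · intro hi l hl
        have hl' : l ∈ E := hl
        simp only [E, Finset.mem_insert, Finset.mem_union, Finset.mem_image, Finset.mem_univ,
          true_and] at hl'
        rcases hl' with rfl | ⟨i, rfl⟩ | ⟨i, rfl⟩
        · rw [hψ]; norm_num
        · rw [key ψ hψ]
          have := mul_pos (hden (r i)) (sub_pos.2 (hi i).1)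
          linarith
        · rw [map_neg, map_neg, key ψ hψ]
          have := mul_pos (hden (p i)) (sub_pos.2 (hi i).2)
          linarith
    refine ⟨E, ?_, ?_⟩
    · rw [mem_VQ_mk, hE φ hφe]
      exact fun i => ⟨hr1 i, hp2 i⟩
    · intro q hq'
      induction q using Quotient.inductionOn with | _ ψ₀ => ?_
      have hψ : ψ₀ (iota Λ e) < 0 := (mem_VQ_mk Λ _ ψ₀).1 hq' e (by simp [E])
      have hk : 0 < (- ψ₀ (iota Λ e))⁻¹ := inv_pos.2 (by linarith)
      rw [← hsc ψ₀ _ hk] at hq' ⊢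
      have hψe : ((- ψ₀ (iota Λ e))⁻¹ • ψ₀) (iota Λ e) = -1 := by
        rw [LinearMap.smul_apply, smul_eq_mul]
        rw [inv_neg, neg_mul, inv_mul_cancel₀ hψ.ne]
      generalize (- ψ₀ (iota Λ e))⁻¹ • ψ₀ = ψ at hq' hψe
      rw [mem_VQ_mk, hE ψ hψe] at hq'
      apply h
      intro i
      have h1 := hq' i
      have h2 := hp1 i
      have h3 := hr2 i
      rw [abs_lt]
      constructor <;> linarith [h1.1, h1.2]
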